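/- Let 0 < λ ≤ 2^{-6}, let P ∈ ℂ^{L×L} with ‖P‖ ≤ 1, let Q ∈ 𝔾_{L,w+1}, and let Φ, Φ̃ ∈ 𝔽_{L,w+1} be frames with Q = ΦΦ* and e^{λP}·Q = Φ̃Φ̃*. Fix 1 ≤ D ≤ L and let P̂_z be the orthogonal projection onto the bottom D coordinates. Set x := Q^⊥P, y := ½[Q^⊥P(Q^⊥−Q) − QP*Q^⊥]P, H₀ := Φ*P̂_zΦ, H₁ := Φ*[P̂_z x + x*P̂_z]Φ, H₂ := Φ*[x*P̂_z x + P̂_z y + y*P̂_z]Φ, and H := H₀ + λH₁ + λ²H₂. Then μ₁(Φ̃*P̂_zΦ̃) ≥ μ₁(H) − 2⁵λ³, where μ₁ denotes the smallest eigenvalue; moreover ‖x‖ ≤ 1, ‖y‖ ≤ 2^{-1/2}, ‖H₀‖ ≤ 1, ‖H₁‖ ≤ 2, and ‖H₂‖ ≤ 1 + 2^{1/2}. -/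

import Mathlib

open Matrix BigOperators

noncomputable section

/-- The squared Euclidean norm of a complex vector. -/
def sqNorm {n : ℕ} (v : Fin n → ℂ) : ℝ := ∑ i, ‖v i‖ ^ 2

/-- The standard Hermitian inner product `⟨u, v⟩` on `ℂ^n`. -/
def dotc {n : ℕ} (u v : Fin n → ℂ) : ℂ := ∑ i, star (u i) * v i

/-- The `ℓ² → ℓ²` operator norm of a rectangular complex matrix. -/
def opNorm {m n : ℕ} (A : Matrix (Fin m) (Fin n) ℂ) : ℝ :=
  ‖LinearMap.toContinuousLinearMap (Matrix.toEuclideanLin A)‖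

/-- Membership in the Grassmannian `𝔾_{L,q}`: an orthogonal projection of rank `q`. -/
def IsProjOfRank {L : ℕ} (q : ℕ) (Q : Matrix (Fin L) (Fin L) ℂ) : Prop :=
  Q * Q = Q ∧ Qᴴ = Q ∧ Q.trace = (q : ℂ)

/-- A frame `Φ ∈ 𝔽_{L,q}`. -/
def IsFrame {L q : ℕ} (Φ : Matrix (Fin L) (Fin q) ℂ) : Prop := Φᴴ * Φ = 1

/-- The action `T · Q` of an invertible matrix `T` on the Grassmannian: for `Q = ΦΦ*` this
equals `TΦ(Φ*T*TΦ)⁻¹Φ*T*`, i.e. the orthogonal projection onto `T (ran Q)`. -/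
def grAct {L : ℕ} (T Q : Matrix (Fin L) (Fin L) ℂ) : Matrix (Fin L) (Fin L) ℂ :=
  T * Q * (Q * Tᴴ * T * Q + (1 - Q))⁻¹ * (Q * Tᴴ)

/-- The matrix exponential. -/
def mexp {n : ℕ} (A : Matrix (Fin n) (Fin n) ℂ) : Matrix (Fin n) (Fin n) ℂ :=
  ∑' k : ℕ, ((k.factorial : ℂ))⁻¹ • A ^ k

/-- The smallest eigenvalue of a Hermitian matrix, via the Rayleigh characterization. -/
def smallestEig {n : ℕ} (A : Matrix (Fin n) (Fin n) ℂ) : ℝ :=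
  sInf {r : ℝ | ∃ v : Fin n → ℂ, sqNorm v = 1 ∧ (dotc v (A.mulVec v)).re = r}

section aux
open scoped Matrix.Norms.L2Operator

theorem nproj {m : ℕ} (A : Matrix (Fin m) (Fin m) ℂ) (h : Aᴴ * A = A) : ‖A‖ ≤ 1 := by
  have h1 := Matrix.l2_opNorm_conjTranspose_mul_self A
  rw [h] at h1
  by_contra hc
  push Not at hc
  nlinarith [norm_nonneg A]

theorem none (m : ℕ) : ‖(1 : Matrix (Fin m) (Fin m) ℂ)‖ ≤ 1 := nproj 1 (by simp)

theorem nframe {m n : ℕ} (A : Matrix (Fin m) (Fin n) ℂ) (h : Aᴴ * A = 1) : ‖A‖ ≤ 1 := by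
  have h1 := Matrix.l2_opNorm_conjTranspose_mul_self A
  rw [h] at h1
  have := none n
  by_contra hc
  push Not at hc
  nlinarith [norm_nonneg A]

theorem nmul {l m n : ℕ} (A : Matrix (Fin l) (Fin m) ℂ) (B : Matrix (Fin m) (Fin n) ℂ) {a b : ℝ}
    (ha : ‖A‖ ≤ a) (hb : ‖B‖ ≤ b) : ‖A * B‖ ≤ a * b :=
  (Matrix.l2_opNorm_mul A B).trans
    (mul_le_mul ha hb (norm_nonneg _) ((norm_nonneg _).trans ha))

theorem nadd {m n : ℕ} {A B : Matrix (Fin m) (Fin n) ℂ} {a b : ℝ}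
    (ha : ‖A‖ ≤ a) (hb : ‖B‖ ≤ b) : ‖A + B‖ ≤ a + b :=
  (norm_add_le A B).trans (add_le_add ha hb)

theorem nsub {m n : ℕ} {A B : Matrix (Fin m) (Fin n) ℂ} {a b : ℝ}
    (ha : ‖A‖ ≤ a) (hb : ‖B‖ ≤ b) : ‖A - B‖ ≤ a + b :=
  (norm_sub_le A B).trans (add_le_add ha hb)

theorem nct {m n : ℕ} {A : Matrix (Fin m) (Fin n) ℂ} {a : ℝ}
    (ha : ‖A‖ ≤ a) : ‖Aᴴ‖ ≤ a := by
  rw [Matrix.l2_opNorm_conjTranspose]; exact ha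

theorem nhalf {m n : ℕ} {A : Matrix (Fin m) (Fin n) ℂ} {a : ℝ}
    (ha : ‖A‖ ≤ a) : ‖(2 : ℂ)⁻¹ • A‖ ≤ a / 2 := by
  rw [norm_smul]; simp; linarith

theorem opNorm_eq' {m n : ℕ} (A : Matrix (Fin m) (Fin n) ℂ) :
  ‖LinearMap.toContinuousLinearMap (Matrix.toEuclideanLin A)‖ = ‖A‖ := rfl

theorem exp_tail {n : ℕ} (A : Matrix (Fin n) (Fin n) ℂ) {t : ℝ} (h0 : 0 ≤ t) (ht : t ≤ 1/64)
    (hA : ‖A‖ ≤ t) :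
    ‖(∑' k : ℕ, ((k.factorial : ℂ))⁻¹ • A ^ k) - (1 + A + (2:ℂ)⁻¹ • (A * A))‖ ≤ t^3 := by
  have hs : Summable (fun k : ℕ => ((k.factorial : ℂ))⁻¹ • A ^ k) :=
    NormedSpace.expSeries_summable' (𝕂 := ℂ) A
  have e := hs.sum_add_tsum_nat_add 3
  have e3 : ∑ i ∈ Finset.range 3, ((i.factorial : ℂ))⁻¹ • A ^ i = 1 + A + (2:ℂ)⁻¹ • (A * A) := by
    simp [Finset.sum_range_succ, Nat.factorial, pow_two]
  rw [← e, e3, add_sub_cancel_left]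
  have hg : HasSum (fun k : ℕ => t^3 / 2 * (1/2:ℝ)^k) (t^3) := by
    have := hasSum_geometric_two.mul_left (t^3/2)
    rwa [show t^3/2*2 = t^3 by ring] at this
  refine tsum_of_norm_bounded hg fun k => ?_
  rw [norm_smul]
  have h1 : ‖A ^ (k+3)‖ ≤ t ^ (k+3) :=
    (norm_pow_le' A (by omega)).trans (pow_le_pow_left₀ (norm_nonneg _) hA _)
  have h2 : ‖(((k+3).factorial : ℂ))⁻¹‖ ≤ 1/2 := by
    rw [norm_inv, Complex.norm_natCast, one_div]
    apply inv_anti₀ (by norm_num)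
    have : 2 ≤ (k+3).factorial := (by omega : 2 ≤ k + 3).trans (Nat.self_le_factorial _)
    exact_mod_cast this
  have h3 : t ^ k ≤ (1/2:ℝ)^k := pow_le_pow_left₀ h0 (by linarith) _
  calc _ ≤ 1/2 * t^(k+3) := mul_le_mul h2 h1 (norm_nonneg _) (by norm_num)
    _ = t^3/2 * t^k := by ring
    _ ≤ _ := by gcongr

theorem core1 {L n : ℕ} {A T : Matrix (Fin L) (Fin L) ℂ} {t : ℝ} (h0 : 0 < t) (ht : t ≤ 1/64)
    (hA : ‖A‖ ≤ t) (hT : ‖T - (1 + A + (2:ℂ)⁻¹ • (A * A))‖ ≤ t^3)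
    {Φ Φt : Matrix (Fin L) (Fin n) ℂ} (hΦ : Φᴴ * Φ = 1) {M : Matrix (Fin n) (Fin n) ℂ}
    (hM : Φt = T * Φ * M) :
    ∃ Z : Matrix (Fin L) (Fin n) ℂ, Φᴴ * Z = 0 ∧ Φt = (Φ + Z) * (Φᴴ * Φt) ∧ ‖Z‖ ≤ 9/8*t ∧
      ‖Z - (1 - Φ * Φᴴ) * A * Φ -
       (2:ℂ)⁻¹ • ((1 - Φ * Φᴴ) * A * ((1 - Φ * Φᴴ) - Φ * Φᴴ) * A * Φ)‖ ≤ 4 * t^3 := by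
  obtain ⟨R, rfl⟩ : ∃ R, T = 1 + A + (2:ℂ)⁻¹ • (A * A) + R := ⟨T - (1 + A + (2:ℂ)⁻¹ • (A * A)), by abel⟩
  rw [add_sub_cancel_left] at hT
  set T := 1 + A + (2:ℂ)⁻¹ • (A * A) + R with hTd
  have nΦ := nframe Φ hΦ
  set W := (1 - Φ * Φᴴ) with hW
  have hWΦ : W * Φ = 0 := by
    rw [hW, Matrix.sub_mul, Matrix.mul_assoc, hΦ]; simp
  have hΦW : Φᴴ * W = 0 := by
    rw [hW, Matrix.mul_sub, ← Matrix.mul_assoc, hΦ]; simp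
  have nW : ‖W‖ ≤ 1 := by
    apply nproj
    have : Wᴴ = W := by simp [hW]
    rw [this]; nth_rw 1 [hW]; rw [Matrix.sub_mul, Matrix.mul_assoc, hΦW]; simp
  set S := Φᴴ * T * Φ with hS
  set s1 := Φᴴ * A * Φ
  set s2 := Φᴴ * ((2:ℂ)⁻¹ • (A * A) + R) * Φ with hs2
  set N1 := W * A * Φ
  set N2 := W * ((2:ℂ)⁻¹ • (A * A) + R) * Φ with hN2
  have eS : S = 1 + (s1 + s2) := by
    simp only [hS, s1, hs2, hTd, Matrix.mul_add, Matrix.add_mul, Matrix.mul_one, hΦ]; abel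
  have eN : W * T * Φ = N1 + N2 := by
    simp only [N1, hN2, hTd, Matrix.mul_add, Matrix.add_mul, Matrix.mul_one, hWΦ]; abel
  have nB : ‖(2:ℂ)⁻¹ • (A * A) + R‖ ≤ t*t/2 + t^3 := nadd (nhalf (nmul _ _ hA hA)) hT
  have n1 : ‖s1‖ ≤ 1 * t * 1 := nmul _ _ (nmul _ _ (nct nΦ) hA) nΦ
  have n2 : ‖s2‖ ≤ 1 * _ * 1 := nmul _ _ (nmul _ _ (nct nΦ) nB) nΦ
  have m1 : ‖N1‖ ≤ 1 * t * 1 := nmul _ _ (nmul _ _ nW hA) nΦ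
  have m2 : ‖N2‖ ≤ 1 * _ * 1 := nmul _ _ (nmul _ _ nW nB) nΦ
  have b2 : 1 * (t*t/2 + t^3) * 1 ≤ 33/64 * t^2 := by nlinarith [sq_nonneg t]
  replace n2 := n2.trans b2
  replace m2 := m2.trans b2
  rw [one_mul, mul_one] at n1 m1
  have b3 : t + 33/64*t^2 ≤ 65/64 * t := by nlinarith
  have ns := (nadd n1 n2).trans b3
  have nN := (nadd m1 m2).trans b3
  have hu : IsUnit S := by
    rw [eS, ← sub_neg_eq_add]
    apply isUnit_one_sub_of_norm_lt_one
    rw [norm_neg]; linarith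
  obtain ⟨G, hSG⟩ := hu.exists_right_inv
  have hGS : G * S = 1 := mul_eq_one_comm.mp hSG
  refine ⟨(N1 + N2) * G, ?_, ?_, ?_⟩
  · rw [← eN]
    simp only [← Matrix.mul_assoc, hΦW]; simp
  · have e1 : Φᴴ * Φt = S * M := by rw [hM, hS]; simp only [Matrix.mul_assoc]
    rw [e1, ← Matrix.mul_assoc, Matrix.add_mul, Matrix.mul_assoc _ G S, hGS, ← eN, hM,
      Matrix.mul_one, hS]
    congr 1
    simp only [hW, Matrix.sub_mul, Matrix.one_mul, Matrix.mul_assoc]; abel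
  set Z := (N1 + N2) * G with hZ
  have eZ : Z = (N1 + N2) - Z * (s1 + s2) := by
    have : Z * S = N1 + N2 := by rw [hZ, Matrix.mul_assoc, hGS, Matrix.mul_one]
    rw [eS, Matrix.mul_add, Matrix.mul_one] at this
    rw [← this]; abel
  have nZ : ‖Z‖ ≤ 9/8 * t := by
    have h : ‖Z‖ ≤ 65/64 * t + ‖Z‖ * (65/64*t) := by
      conv_lhs => rw [eZ]
      exact nsub nN (nmul _ _ le_rfl ns)
    nlinarith [norm_nonneg Z]
  refine ⟨nZ, ?_⟩
  have eE : Z - N1 - (2:ℂ)⁻¹ • (W * A * (W - Φ * Φᴴ) * A * Φ) =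
      W * R * Φ - (N2 * (s1 + s2) + N1 * s2) + Z * (s1 + s2) * (s1 + s2) := by
    have h1 : Z = (N1 + N2) - (N1 + N2) * (s1+s2) + Z * (s1 + s2) * (s1+s2) := by
      conv_lhs => rw [eZ]
      conv_lhs => rw [eZ]
      rw [Matrix.sub_mul]; abel
    have h2 : (2:ℂ)⁻¹ • (W * A * (W - Φ * Φᴴ) * A * Φ) = N2 - W * R * Φ - N1 * s1 := by
      have : W - Φ * Φᴴ = 1 - (2:ℂ) • (Φ * Φᴴ) := by rw [hW]; module
      rw [this]
      simp only [hN2, N1, s1, Matrix.mul_add, Matrix.add_mul, Matrix.mul_sub, Matrix.sub_mul, Matrix.mul_one, Matrix.mul_smul, Matrix.smul_mul, ← Matrix.mul_assoc]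
      module
    rw [h2]
    nth_rw 1 [h1]
    simp only [Matrix.mul_add, Matrix.add_mul]
    abel
  rw [eE]
  have f := nadd (nsub (nmul _ _ (nmul _ _ nW hT) nΦ) (nadd (nmul _ _ m2 ns) (nmul _ _ m1 n2))) (nmul _ _ (nmul _ _ nZ ns) ns)
  refine f.trans ?_
  have : 0 < t^3 := by positivity
  nlinarith

theorem core2 {L n : ℕ} {t : ℝ} (h0 : 0 < t) (ht : t ≤ 1/64)
    {Pz : Matrix (Fin L) (Fin L) ℂ} (hPz : ‖Pz‖ ≤ 1)
    {Φ Φt Z X Y B : Matrix (Fin L) (Fin n) ℂ} {C : Matrix (Fin n) (Fin n) ℂ}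
    (hΦ : Φᴴ * Φ = 1) (hΦt : Φtᴴ * Φt = 1) (hZ : Φᴴ * Z = 0) (hC : C = Φᴴ * Φt)
    (hZC : Φt = (Φ + Z) * C)
    (nZ : ‖Z‖ ≤ 9/8*t) (nX : ‖X‖ ≤ t) (nY : ‖Y‖ ≤ t^2/2) (nB : ‖B‖ ≤ t^2)
    (nE : ‖Z - X - Y‖ ≤ 4 * t^3) (hB : B = Y - (2:ℂ)⁻¹ • (Φ * (Xᴴ * X))) :
    ∃ C' V : Matrix (Fin n) (Fin n) ℂ, C'ᴴ * C' = 1 + Vᴴ * V ∧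
      ‖C'ᴴ * (Φᴴ * Pz * Φ + (Φᴴ * Pz * X + Xᴴ * Pz * Φ) + (Xᴴ * Pz * X + Φᴴ * Pz * B + Bᴴ * Pz * Φ)) * C'
        - Φtᴴ * Pz * Φt‖ ≤ 32 * t^3 := by
  have nΦ := nframe Φ hΦ
  have nΦt := nframe Φt hΦt
  have nC : ‖C‖ ≤ 1 * 1 := hC ▸ nmul _ _ (nct nΦ) nΦt
  rw [one_mul] at nC
  have p2 : t^2 ≤ t/64 := by nlinarith
  have p3 : t^3 ≤ t^2/64 := by nlinarith [sq_nonneg t]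
  have p3' : 0 < t^3 := by positivity
  have p4 : t^4 ≤ t^3/64 := by nlinarith
  have p6 : t^6 ≤ t^3/64 := by nlinarith [pow_le_one₀ h0.le (by linarith : t ≤ 1) (n := 3)]
  have hZ' : Zᴴ * Φ = 0 := by
    have := congrArg conjTranspose hZ
    simpa using this
  have nZZ : ‖Zᴴ * Z‖ ≤ 81/64 * t^2 := (nmul _ _ (nct nZ) nZ).trans (by nlinarith)
  have hh : star (2⁻¹ : ℂ) = 2⁻¹ := by simp
  refine ⟨C + (2:ℂ)⁻¹ • (Zᴴ * Z * C), (2:ℂ)⁻¹ • (Zᴴ * Z * C), ?_, ?_⟩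
  · have e1 : Cᴴ * C + Cᴴ * Zᴴ * Z * C = 1 := by
      rw [← hΦt, hZC]
      simp only [conjTranspose_mul, conjTranspose_add, Matrix.mul_add, Matrix.add_mul]
      have r1 : Cᴴ * Zᴴ * (Φ * C) = 0 := by
        rw [Matrix.mul_assoc, ← Matrix.mul_assoc Zᴴ, hZ']; simp
      have r2 : Cᴴ * Φᴴ * (Z * C) = 0 := by
        rw [Matrix.mul_assoc, ← Matrix.mul_assoc Φᴴ, hZ]; simp
      have r3 : Cᴴ * Φᴴ * (Φ * C) = Cᴴ * C := by
        rw [Matrix.mul_assoc, ← Matrix.mul_assoc Φᴴ, hΦ]; simp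
      rw [r1, r2, r3, ← Matrix.mul_assoc]; abel
    rw [← e1]
    simp only [conjTranspose_mul, conjTranspose_add, conjTranspose_smul, conjTranspose_conjTranspose,
      hh, Matrix.mul_add, Matrix.add_mul, Matrix.mul_smul, Matrix.smul_mul, ← Matrix.mul_assoc]
    module
  set C' := C + (2:ℂ)⁻¹ • (Zᴴ * Z * C) with hC'
  set K := Φ + X + B with hK
  have nC' : ‖C'‖ ≤ 65/64 := by
    refine (nadd nC (nhalf (nmul _ _ nZZ nC))).trans ?_
    nlinarith
  obtain ⟨F, hF⟩ : ∃ F, F = K * C' - Φt := ⟨_, rfl⟩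
  have eF : F = ((2:ℂ)⁻¹ • (Φ * ((Z - X)ᴴ * Z + Xᴴ * (Z - X))) - (Z - X - Y)
      + (2:ℂ)⁻¹ • ((X + B) * (Zᴴ * Z))) * C := by
    rw [hF, hK, hC', hZC, hB]
    simp only [conjTranspose_sub, Matrix.mul_add, Matrix.add_mul, Matrix.mul_sub, Matrix.sub_mul, Matrix.mul_smul, Matrix.smul_mul, ← Matrix.mul_assoc]
    module
  have nZX : ‖Z - X‖ ≤ 9/16 * t^2 := by
    have : Z - X = (Z - X - Y) + Y := by abel
    rw [this]
    refine (nadd nE nY).trans ?_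
    linarith
  have nF : ‖F‖ ≤ 6 * t^3 := by
    rw [eF]
    refine (nmul _ _ (nadd (nsub (nhalf (nmul _ _ nΦ (nadd (nmul _ _ (nct nZX) nZ)
      (nmul _ _ (nct nX) nZX)))) nE) (nhalf (nmul _ _ (nadd nX nB) nZZ))) nC).trans ?_
    nlinarith
  have eH : C'ᴴ * (Φᴴ * Pz * Φ + (Φᴴ * Pz * X + Xᴴ * Pz * Φ) + (Xᴴ * Pz * X + Φᴴ * Pz * B + Bᴴ * Pz * Φ)) * C'
        - Φtᴴ * Pz * Φt = (Fᴴ * Pz * Φt + Φtᴴ * Pz * F + Fᴴ * Pz * F)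
        - C'ᴴ * (Xᴴ * Pz * B + Bᴴ * Pz * X + Bᴴ * Pz * B) * C' := by
    have : Φt = K * C' - F := by rw [hF]; abel
    rw [this, hK]
    simp only [conjTranspose_mul, conjTranspose_add, conjTranspose_sub, Matrix.mul_add, Matrix.add_mul, Matrix.mul_sub, Matrix.sub_mul, ← Matrix.mul_assoc]
    abel
  rw [eH]
  have nX' := nct nX
  have nB' := nct nB
  have nF' := nct nF
  have g1 := nadd (nadd (nmul _ _ (nmul _ _ nF' hPz) nΦt) (nmul _ _ (nmul _ _ (nct nΦt) hPz) nF))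
    (nmul _ _ (nmul _ _ nF' hPz) nF)
  have g2 := nadd (nadd (nmul _ _ (nmul _ _ nX' hPz) nB) (nmul _ _ (nmul _ _ nB' hPz) nX))
    (nmul _ _ (nmul _ _ nB' hPz) nB)
  have g2' := g2.trans (show _ ≤ 3 * t^3 by nlinarith)
  refine (nsub g1 (nmul _ _ (nmul _ _ (nct nC') g2') nC')).trans ?_
  nlinarith

theorem sqNorm_eq {n : ℕ} (v : Fin n → ℂ) : sqNorm v = ‖WithLp.toLp 2 v‖ ^ 2 := by
  rw [EuclideanSpace.norm_sq_eq]; rfl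

theorem dotc_eq {n : ℕ} (u v : Fin n → ℂ) : dotc u v = star u ⬝ᵥ v := rfl

theorem dotc_self {n : ℕ} (v : Fin n → ℂ) : (dotc v v).re = sqNorm v := by
  unfold dotc sqNorm
  rw [Complex.re_sum]
  refine Finset.sum_congr rfl fun i _ => ?_
  rw [← Complex.normSq_eq_norm_sq, Complex.normSq_apply]
  simp

theorem sqNorm_nonneg {n : ℕ} (v : Fin n → ℂ) : 0 ≤ sqNorm v := by
  rw [sqNorm_eq]; positivity

theorem quad_le {n : ℕ} (A : Matrix (Fin n) (Fin n) ℂ) (v : Fin n → ℂ) :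
    |(dotc v (A.mulVec v)).re| ≤ ‖A‖ * sqNorm v := by
  have h1 : dotc v (A.mulVec v) = inner ℂ (WithLp.toLp 2 v) (WithLp.toLp 2 (A.mulVec v)) := by
    rw [EuclideanSpace.inner_eq_star_dotProduct, dotc_eq, dotProduct_comm]
  have h2 : ‖WithLp.toLp 2 (A.mulVec v)‖ ≤ ‖A‖ * ‖WithLp.toLp 2 v‖ :=
    Matrix.l2_opNorm_mulVec A (WithLp.toLp 2 v)
  refine (Complex.abs_re_le_norm _).trans ?_
  rw [h1]
  refine (norm_inner_le_norm _ _).trans ?_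
  rw [sqNorm_eq]
  nlinarith [norm_nonneg (WithLp.toLp 2 v)]

theorem dotc_conj {m n : ℕ} (A : Matrix (Fin m) (Fin m) ℂ) (B : Matrix (Fin m) (Fin n) ℂ)
    (v : Fin n → ℂ) : dotc v ((Bᴴ * A * B).mulVec v) = dotc (B.mulVec v) (A.mulVec (B.mulVec v)) := by
  rw [dotc_eq, dotc_eq, star_mulVec, ← dotProduct_mulVec, mulVec_mulVec, mulVec_mulVec]

theorem eig_le {n : ℕ} (A : Matrix (Fin n) (Fin n) ℂ) (v : Fin n → ℂ) (hv : 1 ≤ sqNorm v)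
    (h0 : 0 ≤ smallestEig A) : smallestEig A ≤ (dotc v (A.mulVec v)).re := by
  have hbdd : BddBelow {r : ℝ | ∃ v : Fin n → ℂ, sqNorm v = 1 ∧ (dotc v (A.mulVec v)).re = r} := by
    refine ⟨-‖A‖, ?_⟩
    rintro r ⟨u, hu, rfl⟩
    have := (abs_le.mp (quad_le A u)).1
    rwa [hu, mul_one] at this
  set s := sqNorm v with hs
  have hs0 : 0 < s := by linarith
  obtain ⟨c, hc⟩ : ∃ c : ℂ, c = (((Real.sqrt s)⁻¹ : ℝ) : ℂ) := ⟨_, rfl⟩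
  have hcn : ‖c‖ ^ 2 = s⁻¹ := by
    rw [hc, Complex.norm_real, Real.norm_eq_abs, sq_abs, inv_pow, Real.sq_sqrt hs0.le]
  have hcc : star c * c = ((s⁻¹ : ℝ) : ℂ) := by
    rw [← hcn]; simp [Complex.conj_mul']
  have h1 : sqNorm (c • v) = 1 := by
    rw [sqNorm_eq, WithLp.toLp_smul, norm_smul, mul_pow, hcn, ← sqNorm_eq, ← hs,
      inv_mul_cancel₀ hs0.ne']
  have h2 : (dotc (c • v) (A.mulVec (c • v))).re = s⁻¹ * (dotc v (A.mulVec v)).re := by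
    rw [dotc_eq, mulVec_smul, star_smul, smul_dotProduct, dotProduct_smul, smul_smul, hcc, dotc_eq,
      smul_eq_mul, Complex.re_ofReal_mul]
  have h3 : smallestEig A ≤ s⁻¹ * (dotc v (A.mulVec v)).re :=
    csInf_le hbdd ⟨c • v, h1, h2⟩
  have h4 : s * smallestEig A ≤ (dotc v (A.mulVec v)).re := by
    have := mul_le_mul_of_nonneg_left h3 hs0.le
    rwa [← mul_assoc, mul_inv_cancel₀ hs0.ne', one_mul] at this
  nlinarith

theorem le_eig {n : ℕ} (A : Matrix (Fin (n+1)) (Fin (n+1)) ℂ) (r : ℝ)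
    (h : ∀ v, sqNorm v = 1 → r ≤ (dotc v (A.mulVec v)).re) : r ≤ smallestEig A := by
  refine le_csInf ?_ ?_
  · exact ⟨_, Pi.single 0 1, by rw [sqNorm_eq]; simp, rfl⟩
  · rintro _ ⟨v, hv, rfl⟩
    exact h v hv

theorem eig_compare {L n : ℕ} (H C' V : Matrix (Fin (n+1)) (Fin (n+1)) ℂ)
    (Pz : Matrix (Fin L) (Fin L) ℂ) (hPz : Pzᴴ * Pz = Pz) (Φt : Matrix (Fin L) (Fin (n+1)) ℂ)
    {e : ℝ} (he : 0 ≤ e)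
    (hC : C'ᴴ * C' = 1 + Vᴴ * V) (hE : ‖C'ᴴ * H * C' - Φtᴴ * Pz * Φt‖ ≤ e) :
    smallestEig (Φtᴴ * Pz * Φt) ≥ smallestEig H - e := by
  apply le_eig
  intro v hv
  by_cases h : 0 ≤ smallestEig H
  · have h1 : 1 ≤ sqNorm (C'.mulVec v) := by
      have e1 : dotc (C'.mulVec v) (C'.mulVec v) = dotc v v + dotc (V.mulVec v) (V.mulVec v) := by
        have a1 := dotc_conj 1 C' v
        have a2 := dotc_conj 1 V v
        rw [Matrix.mul_one, one_mulVec] at a1 a2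
        rw [← a1, ← a2, hC, add_mulVec, one_mulVec]
        simp [dotc_eq, dotProduct_add]
      rw [← dotc_self, e1, Complex.add_re, dotc_self, dotc_self, hv]
      linarith [sqNorm_nonneg (V.mulVec v)]
    have h2 := eig_le H _ h1 h
    have h3 := (abs_le.mp (quad_le (C'ᴴ * H * C' - Φtᴴ * Pz * Φt) v)).2
    rw [sub_mulVec, hv, mul_one] at h3
    have h4 : ∀ a b : Fin (n+1) → ℂ, (dotc v (a - b)).re = (dotc v a).re - (dotc v b).re := by
      intro a b; simp [dotc_eq, dotProduct_sub]
    rw [h4, dotc_conj] at h3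
    linarith
  · have : 0 ≤ (dotc v ((Φtᴴ * Pz * Φt).mulVec v)).re := by
      have e9 : Φtᴴ * Pz * Φt = (Pz * Φt)ᴴ * (1 : Matrix (Fin L) (Fin L) ℂ) * (Pz * Φt) := by
        rw [conjTranspose_mul, Matrix.mul_one, Matrix.mul_assoc Φtᴴ Pzᴴ, ← Matrix.mul_assoc Pzᴴ, hPz,
          Matrix.mul_assoc]
      rw [e9, dotc_conj, one_mulVec, dotc_self]
      exact sqNorm_nonneg _
    push Not at h
    linarith

end aux

open scoped Matrix.Norms.L2Operator in
/-- quantitative Hamiltonian bound, Lemma `lemma-Hamiltonian-bound`: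
`μ₁(Φ̃*P̂_zΦ̃) ≥ μ₁(H₀ + λH₁ + λ²H₂) − 2⁵λ³` together with the norm bounds
`‖x‖ ≤ 1`, `‖y‖ ≤ 2^{-1/2}`, `‖H₀‖ ≤ 1`, `‖H₁‖ ≤ 2`, `‖H₂‖ ≤ 1 + 2^{1/2}`. -/
theorem statement15 (L w D : ℕ) (hD1 : 1 ≤ D) (hDL : D ≤ L)
    (lam : ℝ) (hlam0 : 0 < lam) (hlam : lam ≤ 1 / 2 ^ 6)
    (P : Matrix (Fin L) (Fin L) ℂ) (hP : opNorm P ≤ 1)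
    (Q : Matrix (Fin L) (Fin L) ℂ) (hQ : IsProjOfRank (w + 1) Q)
    (Φ Φt : Matrix (Fin L) (Fin (w + 1)) ℂ) (hΦ : IsFrame Φ) (hΦt : IsFrame Φt)
    (hQΦ : Q = Φ * Φᴴ)
    (hQt : grAct (mexp ((lam : ℂ) • P)) Q = Φt * Φtᴴ)
    (Pz : Matrix (Fin L) (Fin L) ℂ)
    (hPz : Pz = Matrix.diagonal fun i : Fin L => if L - D ≤ (i : ℕ) then (1 : ℂ) else 0)
    (x y : Matrix (Fin L) (Fin L) ℂ)
    (hx : x = (1 - Q) * P)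
    (hy : y = (2 : ℂ)⁻¹ • (((1 - Q) * P * ((1 - Q) - Q) - Q * Pᴴ * (1 - Q)) * P))
    (H0 H1 H2 : Matrix (Fin (w + 1)) (Fin (w + 1)) ℂ)
    (hH0 : H0 = Φᴴ * Pz * Φ)
    (hH1 : H1 = Φᴴ * (Pz * x + xᴴ * Pz) * Φ)
    (hH2 : H2 = Φᴴ * (xᴴ * Pz * x + Pz * y + yᴴ * Pz) * Φ) :
    smallestEig (Φtᴴ * Pz * Φt) ≥
        smallestEig (H0 + (lam : ℂ) • H1 + ((lam : ℂ) ^ 2) • H2) - 2 ^ 5 * lam ^ 3 ∧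
    opNorm x ≤ 1 ∧
    opNorm y ≤ (Real.sqrt 2)⁻¹ ∧
    opNorm H0 ≤ 1 ∧
    opNorm H1 ≤ 2 ∧
    opNorm H2 ≤ 1 + Real.sqrt 2 := by
  obtain ⟨hQ2, hQH, -⟩ := hQ
  have on : ∀ {m n : ℕ} (A : Matrix (Fin m) (Fin n) ℂ), opNorm A = ‖A‖ := fun A => opNorm_eq' A
  simp only [on] at hP ⊢
  have hΦ' : Φᴴ * Φ = 1 := hΦ
  have hΦt' : Φtᴴ * Φt = 1 := hΦt
  have nΦ := nframe Φ hΦ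
  have nQ : ‖Q‖ ≤ 1 := nproj Q (by rw [hQH, hQ2])
  set W := 1 - Q with hW
  have hWH : Wᴴ = W := by simp [hW, hQH]
  have hWW : W * W = W := by
    have h1 : Q * (1 - Q) = 0 := by rw [Matrix.mul_sub, hQ2]; simp
    rw [hW, Matrix.sub_mul, h1]; simp
  have hQW : Q * W = 0 := by rw [hW, Matrix.mul_sub, hQ2]; simp
  have hWQ : W * Q = 0 := by rw [hW, Matrix.sub_mul, hQ2]; simp
  have nW : ‖W‖ ≤ 1 := nproj W (by rw [hWH, hWW])
  have nU : ‖W - Q‖ ≤ 1 := by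
    apply nframe
    rw [conjTranspose_sub, hWH, hQH, Matrix.sub_mul, Matrix.mul_sub W W Q, Matrix.mul_sub Q W Q,
      hWW, hQW, hWQ, hQ2, hW]
    abel
  have hPzP : Pzᴴ * Pz = Pz := by
    rw [hPz, diagonal_conjTranspose, diagonal_mul_diagonal]
    congr 1
    funext i
    simp only [Pi.star_apply]
    split_ifs <;> simp
  have nPz : ‖Pz‖ ≤ 1 := nproj Pz hPzP
  have nx : ‖x‖ ≤ 1 := by
    rw [hx]; simpa using nmul _ _ nW hP
  have s2 : 0 < Real.sqrt 2 := by positivity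
  have s22 : Real.sqrt 2 * Real.sqrt 2 = 2 := Real.mul_self_sqrt (by norm_num)
  have si : (Real.sqrt 2)⁻¹ = Real.sqrt 2 / 2 := by
    rw [inv_eq_iff_eq_inv, inv_div, eq_div_iff s2.ne', s22]
  have ny : ‖y‖ ≤ (Real.sqrt 2)⁻¹ := by
    have hM : ‖W * P * (W - Q) - Q * Pᴴ * W‖ ≤ Real.sqrt 2 := by
      have e := Matrix.l2_opNorm_conjTranspose_mul_self (W * P * (W - Q) - Q * Pᴴ * W)
      have e2 : (W * P * (W - Q) - Q * Pᴴ * W)ᴴ * (W * P * (W - Q) - Q * Pᴴ * W)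
          = (W * P * (W - Q))ᴴ * (W * P * (W - Q)) + (Q * Pᴴ * W)ᴴ * (Q * Pᴴ * W) := by
        have z1 : (W * P * (W - Q))ᴴ * (Q * Pᴴ * W) = 0 := by
          have : (W * P * (W - Q))ᴴ * (Q * Pᴴ * W) = (P * (W - Q))ᴴ * (W * Q) * (Pᴴ * W) := by
            simp only [conjTranspose_mul, hWH, Matrix.mul_assoc]
          rw [this, hWQ]; simp
        have z2 : (Q * Pᴴ * W)ᴴ * (W * P * (W - Q)) = 0 := by
          have := congrArg conjTranspose z1
          rwa [conjTranspose_mul, conjTranspose_conjTranspose, conjTranspose_zero] at this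
        generalize W * P * (W - Q) = B1 at z1 z2 ⊢
        generalize Q * Pᴴ * W = B2 at z1 z2 ⊢
        rw [conjTranspose_sub, Matrix.sub_mul, Matrix.mul_sub, Matrix.mul_sub, z1, z2]
        abel
      have b1 := nmul _ _ (nmul _ _ nW hP) nU
      have b2 := nmul _ _ (nmul _ _ nQ (nct hP)) nW
      have b := nadd (nmul _ _ (nct b1) b1) (nmul _ _ (nct b2) b2)
      rw [← e2, e] at b
      apply Real.le_sqrt_of_sq_le
      linarith
    rw [hy, si]
    simpa using nhalf (nmul _ _ hM hP)
  have nr : (Real.sqrt 2)⁻¹ ≤ 1 := by rw [si]; nlinarith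
  refine ⟨?_, nx, ny, ?_, ?_, ?_⟩
  · -- main estimate
    set T := mexp ((lam : ℂ) • P) with hT
    set t := lam
    have ht : t ≤ 1/64 := by norm_num at hlam ⊢; exact hlam
    have nt : ‖(t : ℂ)‖ = t := by rw [Complex.norm_real, Real.norm_eq_abs, abs_of_pos hlam0]
    have nA : ‖(t : ℂ) • P‖ ≤ t := by
      rw [norm_smul, nt]; nlinarith
    have hTail := exp_tail _ hlam0.le ht nA
    obtain ⟨M, hM⟩ : ∃ M : Matrix (Fin (w + 1)) (Fin (w + 1)) ℂ, Φt = T * Φ * M := by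
      have h1 : Φt = grAct T Q * Φt := by rw [hQt, Matrix.mul_assoc, hΦt', Matrix.mul_one]
      obtain ⟨J, hJ⟩ : ∃ J, J = (Q * Tᴴ * T * Q + (1 - Q))⁻¹ := ⟨_, rfl⟩
      refine ⟨Φᴴ * J * (Q * Tᴴ) * Φt, ?_⟩
      have h2 : grAct T Q = T * (Φ * Φᴴ) * J * (Q * Tᴴ) := by
        rw [grAct, ← hJ, ← hQΦ]
      rw [h2] at h1
      refine h1.trans ?_
      simp only [Matrix.mul_assoc]
    obtain ⟨Z, z1, z2, z3, z4⟩ := core1 hlam0 ht nA hTail hΦ' hM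
    rw [← hQΦ, ← hW] at z4
    have ht2 : ‖((t : ℂ)^2)‖ = t^2 := by rw [norm_pow, nt]
    have nX : ‖W * ((t:ℂ) • P) * Φ‖ ≤ t := by simpa using nmul _ _ (nmul _ _ nW nA) nΦ
    have nY : ‖(2:ℂ)⁻¹ • (W * ((t:ℂ) • P) * (W - Q) * ((t:ℂ) • P) * Φ)‖ ≤ t^2/2 := by
      simpa [pow_two] using
        nhalf (nmul _ _ (nmul _ _ (nmul _ _ (nmul _ _ nW nA) nU) nA) nΦ)
    have nB : ‖((t:ℂ)^2 • y) * Φ‖ ≤ t^2 := by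
      have : ‖(t:ℂ)^2 • y‖ ≤ t^2 := by
        rw [norm_smul, ht2]; nlinarith [sq_nonneg t]
      simpa using nmul _ _ this nΦ
    have hB : ((t:ℂ)^2 • y) * Φ = (2:ℂ)⁻¹ • (W * ((t:ℂ) • P) * (W - Q) * ((t:ℂ) • P) * Φ)
        - (2:ℂ)⁻¹ • (Φ * ((W * ((t:ℂ) • P) * Φ)ᴴ * (W * ((t:ℂ) • P) * Φ))) := by
      have h1 : (Φ * ((W * ((t:ℂ) • P) * Φ)ᴴ * (W * ((t:ℂ) • P) * Φ)))
          = (t:ℂ)^2 • (Q * Pᴴ * W * P * Φ) := by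
        have : Φ * ((W * P * Φ)ᴴ * (W * P * Φ)) = (Φ * Φᴴ) * Pᴴ * (W * W) * P * Φ := by
          simp only [conjTranspose_mul, hWH, Matrix.mul_assoc]
        rw [← hQΦ, hWW] at this
        rw [← this]
        simp only [conjTranspose_mul, conjTranspose_smul, Matrix.mul_smul, Matrix.smul_mul, smul_smul,
          Complex.star_def, Complex.conj_ofReal, pow_two]
      rw [h1, hy]
      simp only [Matrix.mul_smul, Matrix.smul_mul, Matrix.sub_mul]
      module
    obtain ⟨C', V, c1, c2⟩ := core2 hlam0 ht nPz hΦ' hΦt' z1 rfl z2 z3 nX nY nB z4 hB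
    refine eig_compare _ C' V Pz hPzP Φt (by positivity) c1 ?_
    have eH : H0 + (t : ℂ) • H1 + ((t : ℂ) ^ 2) • H2 = 
        (Φᴴ * Pz * Φ + (Φᴴ * Pz * (W * ((t:ℂ) • P) * Φ) + (W * ((t:ℂ) • P) * Φ)ᴴ * Pz * Φ) +
        ((W * ((t:ℂ) • P) * Φ)ᴴ * Pz * (W * ((t:ℂ) • P) * Φ) + Φᴴ * Pz * (((t:ℂ)^2 • y) * Φ)
          + (((t:ℂ)^2 • y) * Φ)ᴴ * Pz * Φ)) := by
      have st : star (t : ℂ) = t := Complex.conj_ofReal t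
      rw [hH0, hH1, hH2, Matrix.mul_smul W, ← hx]
      simp only [conjTranspose_mul, conjTranspose_smul, st, star_pow, Matrix.mul_add, Matrix.add_mul,
        Matrix.mul_smul, Matrix.smul_mul, smul_smul, smul_add, ← Matrix.mul_assoc]
      module
    rw [eH]
    refine c2.trans (le_of_eq ?_)
    norm_num
  · rw [hH0]; simpa using nmul _ _ (nmul _ _ (nct nΦ) nPz) nΦ
  · rw [hH1]
    refine (nmul _ _ (nmul _ _ (nct nΦ) (nadd (nmul _ _ nPz nx) (nmul _ _ (nct nx) nPz))) nΦ).trans ?_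
    norm_num
  · rw [hH2]
    refine (nmul _ _ (nmul _ _ (nct nΦ) (nadd (nadd (nmul _ _ (nmul _ _ (nct nx) nPz) nx)
      (nmul _ _ nPz ny)) (nmul _ _ (nct ny) nPz))) nΦ).trans ?_
    rw [si]; linarith

end
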